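/- Let d ≥ 2 be an even integer, let a, e be indeterminates, and let n be a positive integer with n ≡ d+1 (mod 2d). Then the following identity of rational functions in q, a, e holds: Σ_{k=0}^{(dn+n−1)/(2d)} (1−q^{3dk+1−dn−n}) (q^{1−dn−n},e,q^{1+d−dn−n}/e; q^{2d})_k (aq,q/a,q^{d−1−dn−n}; q^d)_k / ((1−q^{1−dn−n}) (q^d,e,q^{1+d−dn−n}/e; q^d)_k (aq^{2d−dn−n},q^{2d−dn−n}/a,q^{d+2}; q^{2d})_k) · q^{dk} = 0. -/

import Mathlib

open Finset

noncomputable section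

abbrev R3 : Type := MvPolynomial (Fin 3) ℚ
abbrev K3 : Type := FractionRing R3

/-- The variable `q` as a rational function in `ℚ(q,a,e)`. -/
def qv : K3 := algebraMap R3 K3 (MvPolynomial.X 0)

/-- The indeterminate `a` as a rational function in `ℚ(q,a,e)`. -/
def av : K3 := algebraMap R3 K3 (MvPolynomial.X 1)

/-- The indeterminate `e` as a rational function in `ℚ(q,a,e)`. -/
def ev : K3 := algebraMap R3 K3 (MvPolynomial.X 2)

/-- The q-shifted factorial `(a; q)_k = (1-a)(1-aq)⋯(1-aq^{k-1})`. -/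
def qPoch {R : Type*} [CommRing R] (a q : R) (k : ℕ) : R :=
  ∏ j ∈ Finset.range k, (1 - a * q ^ j)

section QuadraticSum

variable {K : Type*} [Field K]

lemma qPoch_succ (u q : K) (k : ℕ) : qPoch u q (k + 1) = qPoch u q k * (1 - u * q ^ k) :=
  Finset.prod_range_succ _ _

/-- Shifting the parameter of a q-shifted factorial by one power of the base. -/
lemma qPoch_shift (u q : K) (k : ℕ) :
    (1 - u) * qPoch (u * q) q k = qPoch u q k * (1 - u * q ^ k) := by
  rw [← qPoch_succ, qPoch, qPoch, Finset.prod_range_succ', mul_comm]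
  simp only [pow_zero, mul_one]
  congr 1
  exact Finset.prod_congr rfl fun j _ => by ring

lemma qPoch_ne_zero {u q : K} {k : ℕ} (h : ∀ j : ℕ, u * q ^ j ≠ 1) : qPoch u q k ≠ 0 :=
  Finset.prod_ne_zero_iff.mpr fun j _ => sub_ne_zero.mpr (h j).symm

lemma qPoch_eq_zero {u q : K} {j k : ℕ} (hjk : j < k) (h : u * q ^ j = 1) : qPoch u q k = 0 :=
  Finset.prod_eq_zero (Finset.mem_range.mpr hjk) (by rw [h, sub_self])

/-- The summand of the quadratic series, without the constant factor `1 / (1 - x)`. -/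
def quadTerm (p e b c x : K) (k : ℕ) : K :=
  (1 - x * p ^ (3 * k)) *
    (qPoch x (p ^ 2) k * qPoch e (p ^ 2) k * qPoch (x * p / e) (p ^ 2) k) *
    (qPoch b p k * qPoch c p k * qPoch (x * p / (b * c)) p k) /
    ((qPoch p p k * qPoch e p k * qPoch (x * p / e) p k) *
      (qPoch (x * p ^ 2 / c) (p ^ 2) k * qPoch (x * p ^ 2 / b) (p ^ 2) k *
        qPoch (b * c * p) (p ^ 2) k)) * p ^ k

/-- A common divisor of `quadTerm p e b c x` and `quadTerm p e b c (x * p ^ 2)`. -/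
def quadBase (p e b c x : K) (k : ℕ) : K :=
  (qPoch x (p ^ 2) k * qPoch e (p ^ 2) k * qPoch (x * p / e) (p ^ 2) k) *
    (qPoch b p k * qPoch c p k * qPoch (x * p / (b * c)) p k) /
    ((qPoch p p k * qPoch e p k * qPoch (x * p ^ 3 / e) p k) *
      (qPoch (x * p ^ 4 / c) (p ^ 2) k * qPoch (x * p ^ 4 / b) (p ^ 2) k *
        qPoch (b * c * p) (p ^ 2) k)) * p ^ k

lemma quadTerm_shift_eq (p e b c x : K) (k : ℕ) :
    (1 - x) * (1 - x * p / e) * (1 - x * p / (b * c)) * (1 - x * p ^ 2 / (b * c)) *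
      quadTerm p e b c (x * p ^ 2) k =
    quadBase p e b c x k * ((1 - x * p ^ 2 * (p ^ k) ^ 3) * (1 - x * (p ^ k) ^ 2) *
      (1 - x * p / e * (p ^ k) ^ 2) * (1 - x * p / (b * c) * p ^ k) *
      (1 - x * p ^ 2 / (b * c) * p ^ k)) := by
  have h1 := qPoch_shift x (p ^ 2) k
  have h2 := qPoch_shift (x * p / e) (p ^ 2) k
  have h3 := qPoch_shift (x * p / (b * c)) p k
  have h4 := qPoch_shift (x * p ^ 2 / (b * c)) p k
  have hk : (p ^ 2) ^ k = (p ^ k) ^ 2 := pow_right_comm p 2 k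
  have hk3 : p ^ (3 * k) = (p ^ k) ^ 3 := by rw [mul_comm, pow_mul]
  rw [hk] at h1 h2
  rw [show x * p / e * p ^ 2 = x * p ^ 2 * p / e by ring] at h2
  rw [show x * p / (b * c) * p = x * p ^ 2 / (b * c) by ring] at h3
  rw [show x * p ^ 2 / (b * c) * p = x * p ^ 2 * p / (b * c) by ring] at h4
  have h34 : (1 - x * p / (b * c)) * (1 - x * p ^ 2 / (b * c)) *
      qPoch (x * p ^ 2 * p / (b * c)) p k =
      qPoch (x * p / (b * c)) p k * (1 - x * p / (b * c) * p ^ k) *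
        (1 - x * p ^ 2 / (b * c) * p ^ k) := by
    rw [mul_assoc, h4, ← mul_assoc, h3]
  rw [quadTerm, quadBase, hk3, show x * p ^ 2 * p ^ 2 = x * p ^ 4 by ring]
  calc _ = (1 - x * p ^ 2 * (p ^ k) ^ 3) * (((1 - x) * qPoch (x * p ^ 2) (p ^ 2) k) *
        qPoch e (p ^ 2) k * ((1 - x * p / e) * qPoch (x * p ^ 2 * p / e) (p ^ 2) k)) *
        (qPoch b p k * qPoch c p k * ((1 - x * p / (b * c)) * (1 - x * p ^ 2 / (b * c)) *
          qPoch (x * p ^ 2 * p / (b * c)) p k)) /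
        ((qPoch p p k * qPoch e p k * qPoch (x * p ^ 2 * p / e) p k) *
      (qPoch (x * p ^ 4 / c) (p ^ 2) k * qPoch (x * p ^ 4 / b) (p ^ 2) k *
        qPoch (b * c * p) (p ^ 2) k)) * p ^ k := by ring
    _ = _ := by
      rw [h1, h2, h34, show x * p ^ 2 * p / e = x * p ^ 3 / e by ring]
      ring

lemma quadTerm_eq {p e b c x : K} (he : ∀ j : ℕ, x * p / e * p ^ j ≠ 1)
    (hb : ∀ j : ℕ, x * p ^ 2 / b * p ^ j ≠ 1) (hc : ∀ j : ℕ, x * p ^ 2 / c * p ^ j ≠ 1) (k : ℕ) :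
    (1 - x * p / e) * (1 - x * p ^ 2 / e) * (1 - x * p ^ 2 / b) * (1 - x * p ^ 2 / c) *
      quadTerm p e b c x k =
    quadBase p e b c x k * ((1 - x * (p ^ k) ^ 3) * (1 - x * p / e * p ^ k) *
      (1 - x * p ^ 2 / e * p ^ k) * (1 - x * p ^ 2 / b * (p ^ k) ^ 2) *
      (1 - x * p ^ 2 / c * (p ^ k) ^ 2)) := by
  have h1 := qPoch_shift (x * p ^ 2 / b) (p ^ 2) k
  have h2 := qPoch_shift (x * p ^ 2 / c) (p ^ 2) k
  have h3 := qPoch_shift (x * p / e) p k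
  have h4 := qPoch_shift (x * p ^ 2 / e) p k
  have hk : (p ^ 2) ^ k = (p ^ k) ^ 2 := pow_right_comm p 2 k
  have hk3 : p ^ (3 * k) = (p ^ k) ^ 3 := by rw [mul_comm, pow_mul]
  rw [hk] at h1 h2
  rw [show x * p ^ 2 / b * p ^ 2 = x * p ^ 4 / b by ring] at h1
  rw [show x * p ^ 2 / c * p ^ 2 = x * p ^ 4 / c by ring] at h2
  rw [show x * p / e * p = x * p ^ 2 / e by ring] at h3
  rw [show x * p ^ 2 / e * p = x * p ^ 3 / e by ring] at h4
  have h34 : (1 - x * p / e) * (1 - x * p ^ 2 / e) * qPoch (x * p ^ 3 / e) p k =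
      qPoch (x * p / e) p k * (1 - x * p / e * p ^ k) * (1 - x * p ^ 2 / e * p ^ k) := by
    rw [mul_assoc, h4, ← mul_assoc, h3]
  have ne_e : qPoch (x * p / e) p k ≠ 0 := qPoch_ne_zero he
  have ne_e' : qPoch (x * p ^ 3 / e) p k ≠ 0 := qPoch_ne_zero fun j => by
    convert he (j + 2) using 1; ring
  have ne_b : qPoch (x * p ^ 2 / b) (p ^ 2) k ≠ 0 := qPoch_ne_zero fun j => by
    convert hb (2 * j) using 1; ring
  have ne_b' : qPoch (x * p ^ 4 / b) (p ^ 2) k ≠ 0 := qPoch_ne_zero fun j => by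
    convert hb (2 * j + 2) using 1; ring
  have ne_c : qPoch (x * p ^ 2 / c) (p ^ 2) k ≠ 0 := qPoch_ne_zero fun j => by
    convert hc (2 * j) using 1; ring
  have ne_c' : qPoch (x * p ^ 4 / c) (p ^ 2) k ≠ 0 := qPoch_ne_zero fun j => by
    convert hc (2 * j + 2) using 1; ring
  have e34 := (div_eq_div_iff ne_e ne_e').mpr
    (h34.trans (by ring : _ = (1 - x * p / e * p ^ k) * (1 - x * p ^ 2 / e * p ^ k) *
      qPoch (x * p / e) p k))
  have e1 := (div_eq_div_iff ne_b ne_b').mpr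
    (h1.trans (mul_comm _ _))
  have e2 := (div_eq_div_iff ne_c ne_c').mpr
    (h2.trans (mul_comm _ _))
  rw [quadTerm, quadBase, hk3]
  calc _ = (1 - x * (p ^ k) ^ 3) *
      (qPoch x (p ^ 2) k * qPoch e (p ^ 2) k * qPoch (x * p / e) (p ^ 2) k) *
      (qPoch b p k * qPoch c p k * qPoch (x * p / (b * c)) p k) /
      (qPoch p p k * qPoch e p k * qPoch (b * c * p) (p ^ 2) k) * p ^ k *
      ((1 - x * p / e) * (1 - x * p ^ 2 / e) / qPoch (x * p / e) p k) *
      ((1 - x * p ^ 2 / b) / qPoch (x * p ^ 2 / b) (p ^ 2) k) *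
      ((1 - x * p ^ 2 / c) / qPoch (x * p ^ 2 / c) (p ^ 2) k) := by
        simp only [div_eq_mul_inv, mul_inv]; ring
    _ = _ := by
      rw [e34, e1, e2]
      simp only [div_eq_mul_inv, mul_inv]; ring

lemma quadBase_succ {p e b c x : K} (hp : ∀ j : ℕ, p * p ^ j ≠ 1) (he : ∀ j : ℕ, e * p ^ j ≠ 1)
    (hxe : ∀ j : ℕ, x * p ^ 3 / e * p ^ j ≠ 1) (hb : ∀ j : ℕ, x * p ^ 4 / b * p ^ j ≠ 1)
    (hc : ∀ j : ℕ, x * p ^ 4 / c * p ^ j ≠ 1) (hbc : ∀ j : ℕ, b * c * p * p ^ j ≠ 1) (k : ℕ) :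
    quadBase p e b c x (k + 1) * ((1 - p * p ^ k) * (1 - e * p ^ k) *
      (1 - x * p ^ 3 / e * p ^ k) * (1 - x * p ^ 4 / b * (p ^ k) ^ 2) *
      (1 - x * p ^ 4 / c * (p ^ k) ^ 2) * (1 - b * c * p * (p ^ k) ^ 2)) =
    quadBase p e b c x k * (p * (1 - x * (p ^ k) ^ 2) * (1 - e * (p ^ k) ^ 2) *
      (1 - x * p / e * (p ^ k) ^ 2) * (1 - b * p ^ k) * (1 - c * p ^ k) *
      (1 - x * p / (b * c) * p ^ k)) := by
  have hsq (u : K) (h : ∀ j : ℕ, u * p ^ j ≠ 1) : 1 - u * (p ^ k) ^ 2 ≠ 0 := by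
    rw [← pow_mul]; exact sub_ne_zero.mpr (h _).symm
  have h1 : 1 - p * p ^ k ≠ 0 := sub_ne_zero.mpr (hp k).symm
  have h2 : 1 - e * p ^ k ≠ 0 := sub_ne_zero.mpr (he k).symm
  have h3 : 1 - x * p ^ 3 / e * p ^ k ≠ 0 := sub_ne_zero.mpr (hxe k).symm
  have h4 := hsq _ hb
  have h5 := hsq _ hc
  have h6 := hsq _ hbc
  simp only [quadBase, qPoch_succ, pow_right_comm p 2 k, pow_succ p k]
  generalize 1 - p * p ^ k = w1 at *
  generalize 1 - e * p ^ k = w2 at *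
  generalize 1 - x * p ^ 3 / e * p ^ k = w3 at *
  generalize 1 - x * p ^ 4 / b * (p ^ k) ^ 2 = w4 at *
  generalize 1 - x * p ^ 4 / c * (p ^ k) ^ 2 = w5 at *
  generalize 1 - b * c * p * (p ^ k) ^ 2 = w6 at *
  have hw : w1⁻¹ * w2⁻¹ * w3⁻¹ * w4⁻¹ * w5⁻¹ * w6⁻¹ * (w1 * w2 * w3 * w4 * w5 * w6) = 1 := by
    field_simp
  generalize w1 * w2 * w3 * w4 * w5 * w6 = w at *
  rw [← mul_one (_ * (p * _ * _ * _ * _ * _ * _)), ← hw]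
  simp only [div_eq_mul_inv, mul_inv]
  ring

/-- The polynomial identity behind the telescoping of the shift `x ↦ x * p ^ 2`. -/
lemma quad_certificate {p e b c y : K} (x : K) (hp : p ≠ 0) (he : e ≠ 0) (hb : b ≠ 0) (hc : c ≠ 0)
    (hy : y ≠ 0) :
    (1 - x * p ^ 2 / (b * e)) * (1 - x * p ^ 2 / (c * e)) *
      ((1 - x * p ^ 2 * y ^ 3) * (1 - x * y ^ 2) *
        (1 - x * p / e * y ^ 2) * (1 - x * p / (b * c) * y) * (1 - x * p ^ 2 / (b * c) * y)) -
    (1 - x * p / (b * c)) * (1 - x * p ^ 2 / (b * c * e)) *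
      ((1 - x * y ^ 3) * (1 - x * p / e * y) *
        (1 - x * p ^ 2 / e * y) * (1 - x * p ^ 2 / b * y ^ 2) * (1 - x * p ^ 2 / c * y ^ 2)) =
    x * p ^ 2 / (b * c * e) *
      (p * (1 - x * y ^ 2) * (1 - e * y ^ 2) * (1 - x * p / e * y ^ 2) * (1 - b * y) *
        (1 - c * y) * (1 - x * p / (b * c) * y) *
        ((p * y)⁻¹ - x ^ 2 * p ^ 2 / (b * c * e) * (p * y)) -
      (1 - y) * (1 - e / p * y) * (1 - x * p ^ 2 / e * y) * (1 - x * p ^ 2 / b * y ^ 2) *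
        (1 - x * p ^ 2 / c * y ^ 2) * (1 - b * c / p * y ^ 2) *
        (y⁻¹ - x ^ 2 * p ^ 2 / (b * c * e) * y)) := by
  field_simp
  ring

/-- The factor of the telescoping certificate of the shift `x ↦ x * p ^ 2`. -/
def quadCert (p e b c x y : K) : K :=
  x * p ^ 2 / (b * c * e) *
    ((1 - y) * (1 - e / p * y) * (1 - x * p ^ 2 / e * y) * (1 - x * p ^ 2 / b * y ^ 2) *
      (1 - x * p ^ 2 / c * y ^ 2) * (1 - b * c / p * y ^ 2) *
      (y⁻¹ - x ^ 2 * p ^ 2 / (b * c * e) * y))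

/-- The quadratic series terminating at `x = p ^ (-2 * N)` vanishes. -/
theorem sum_quadTerm_eq_zero {p e b c : K} (hp0 : p ≠ 0) (he0 : e ≠ 0) (hb0 : b ≠ 0) (hc0 : c ≠ 0)
    (hp : ∀ j : ℕ, p * p ^ j ≠ 1) (he : ∀ m : ℤ, e ≠ p ^ m) (hb : ∀ m : ℤ, b ≠ p ^ m)
    (hc : ∀ m : ℤ, c ≠ p ^ m) (hbc : ∀ j : ℕ, b * c * p ^ j ≠ 1)
    (hbce : ∀ m : ℤ, b * c * e ≠ p ^ m) (N : ℕ) :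
    ∑ k ∈ Finset.range (N + 1), quadTerm p e b c (p ^ (-2 * N : ℤ)) k = 0 := by
  induction N with
  | zero => simp [quadTerm]
  | succ N ih =>
    set x : K := p ^ (-2 * (N + 1 : ℕ) : ℤ) with hx
    have hxp : x * p ^ (2 * (N + 1)) = 1 := by
      rw [hx, ← zpow_natCast, ← zpow_add₀ hp0]
      simp
    have hx2 : p ^ (-2 * N : ℤ) = x * p ^ 2 := by
      rw [hx, ← zpow_natCast, ← zpow_add₀ hp0]
      congr 1
      push_cast
      ring
    have quot_ne {u : K} (hu0 : u ≠ 0) (hu : ∀ m : ℤ, u ≠ p ^ m) (i j : ℕ) :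
        x * p ^ i / u * p ^ j ≠ 1 := by
      intro h
      refine hu (-2 * (N + 1 : ℕ) + i + j) ?_
      rw [zpow_add₀ hp0, zpow_add₀ hp0, zpow_natCast, zpow_natCast, ← hx]
      field_simp at h
      exact h.symm
    have hbc0 : b * c * e ≠ 0 := by positivity
    have he' (j : ℕ) : e * p ^ j ≠ 1 := fun h => he (-j) <| by
      rw [zpow_neg, zpow_natCast]
      exact eq_inv_of_mul_eq_one_left h
    rw [hx2] at ih
    have hzero : qPoch (x * p ^ 2) (p ^ 2) (N + 1) = 0 := qPoch_eq_zero (Nat.lt_succ_self N) <| by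
      rw [← hxp]
      ring
    have hlast : quadTerm p e b c (x * p ^ 2) (N + 1) = 0 := by simp [quadTerm, hzero]
    have hend : quadBase p e b c x (N + 2) = 0 := by
      have : qPoch x (p ^ 2) (N + 2) = 0 := qPoch_eq_zero (Nat.lt_succ_self (N + 1)) <| by
        rw [← hxp]
        ring
      simp [quadBase, this]
    have htel (k : ℕ) :
        (1 - x * p ^ 2 / (b * e)) * (1 - x * p ^ 2 / (c * e)) *
          ((1 - x) * (1 - x * p / e) * (1 - x * p / (b * c)) * (1 - x * p ^ 2 / (b * c)) *
            quadTerm p e b c (x * p ^ 2) k) -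
        (1 - x * p / (b * c)) * (1 - x * p ^ 2 / (b * c * e)) *
          ((1 - x * p / e) * (1 - x * p ^ 2 / e) * (1 - x * p ^ 2 / b) * (1 - x * p ^ 2 / c) *
            quadTerm p e b c x k) =
        quadBase p e b c x (k + 1) * quadCert p e b c x (p ^ (k + 1)) -
          quadBase p e b c x k * quadCert p e b c x (p ^ k) := by
      rw [quadTerm_shift_eq, quadTerm_eq (by simpa using quot_ne he0 he 1) (quot_ne hb0 hb 2)
        (quot_ne hc0 hc 2)]
      have hs := quadBase_succ hp he' (quot_ne he0 he 3) (quot_ne hb0 hb 4) (quot_ne hc0 hc 4)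
        (fun j => by simpa [pow_succ', mul_assoc] using hbc (j + 1)) k
      have hcert := quad_certificate x hp0 he0 hb0 hc0 (pow_ne_zero k hp0)
      have hC : quadCert p e b c x (p ^ (k + 1)) =
          ((1 - p * p ^ k) * (1 - e * p ^ k) *
            (1 - x * p ^ 3 / e * p ^ k) * (1 - x * p ^ 4 / b * (p ^ k) ^ 2) *
            (1 - x * p ^ 4 / c * (p ^ k) ^ 2) * (1 - b * c * p * (p ^ k) ^ 2)) *
          (x * p ^ 2 / (b * c * e) *
            ((p * p ^ k)⁻¹ - x ^ 2 * p ^ 2 / (b * c * e) * (p * p ^ k))) := by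
        have h1 : e / p * (p * p ^ k) = e * p ^ k := by field_simp
        have h2 : b * c / p * (p * p ^ k) ^ 2 = b * c * p * (p ^ k) ^ 2 := by field_simp
        have h3 : x * p ^ 2 / e * (p * p ^ k) = x * p ^ 3 / e * p ^ k := by ring
        have h4 : x * p ^ 2 / b * (p * p ^ k) ^ 2 = x * p ^ 4 / b * (p ^ k) ^ 2 := by ring
        have h5 : x * p ^ 2 / c * (p * p ^ k) ^ 2 = x * p ^ 4 / c * (p ^ k) ^ 2 := by ring
        rw [pow_succ', quadCert, h1, h2, h3, h4, h5]
        generalize (p * p ^ k)⁻¹ - _ = w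
        ring
      rw [hC, ← mul_assoc (quadBase p e b c x (k + 1)), hs, quadCert]
      linear_combination quadBase p e b c x k * hcert
    have hsum := Finset.sum_congr (rfl : Finset.range (N + 2) = _) fun k _ => htel k
    rw [Finset.sum_range_sub (fun k => quadBase p e b c x k * quadCert p e b c x (p ^ k)), hend,
      Finset.sum_sub_distrib, ← Finset.mul_sum, ← Finset.mul_sum, ← Finset.mul_sum,
      ← Finset.mul_sum, Finset.sum_range_succ (quadTerm p e b c (x * p ^ 2)), ih, hlast] at hsum
    have hcert0 : quadCert p e b c x (p ^ 0) = 0 := by simp [quadCert]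
    have one_sub_ne {u : K} (hu0 : u ≠ 0) (hu : ∀ m : ℤ, u ≠ p ^ m) (i : ℕ) :
        1 - x * p ^ i / u ≠ 0 :=
      sub_ne_zero.mpr fun h => quot_ne hu0 hu i 0 (by simpa using h.symm)
    have hbc1 : 1 - x * p / (b * c) ≠ 0 := by
      refine sub_ne_zero.mpr fun h => hbc (2 * N + 1) ?_
      rw [eq_div_iff (mul_ne_zero hb0 hc0), one_mul] at h
      rw [h, ← hxp]
      ring
    have hfac : (1 - x * p / (b * c)) * (1 - x * p ^ 2 / (b * c * e)) *
        ((1 - x * p / e) * (1 - x * p ^ 2 / e) * (1 - x * p ^ 2 / b) * (1 - x * p ^ 2 / c)) ≠ 0 :=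
      mul_ne_zero (mul_ne_zero hbc1 (one_sub_ne hbc0 hbce 2))
        (mul_ne_zero (mul_ne_zero (mul_ne_zero (by simpa using one_sub_ne he0 he 1)
          (one_sub_ne he0 he 2)) (one_sub_ne hb0 hb 2)) (one_sub_ne hc0 hc 2))
    refine (mul_eq_zero.mp ?_).resolve_left hfac
    rw [hcert0] at hsum
    linear_combination -hsum

end QuadraticSum

lemma algebraMap_mul_pow_ne {i : Fin 3} (hi : i ≠ 0) (m n : ℕ) :
    algebraMap R3 K3 (MvPolynomial.X i) * qv ^ m ≠ qv ^ n := by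
  intro h
  rw [qv, ← map_pow, ← map_pow, ← map_mul] at h
  have h2 := congrArg (MvPolynomial.eval fun j : Fin 3 => if j = 0 then (1 : ℚ) else 2)
    (IsFractionRing.injective R3 K3 h)
  simp [hi] at h2

lemma algebraMap_ne_zpow {i : Fin 3} (hi : i ≠ 0) (m : ℤ) :
    algebraMap R3 K3 (MvPolynomial.X i) ≠ qv ^ m := by
  intro h
  obtain ⟨n, rfl | rfl⟩ := m.eq_nat_or_neg
  · exact algebraMap_mul_pow_ne hi 0 n (by simpa using h)
  · refine algebraMap_mul_pow_ne hi n 0 ?_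
    have hq : qv ≠ 0 := by simp [qv]
    rw [h, zpow_neg, zpow_natCast, inv_mul_cancel₀ (pow_ne_zero n hq), pow_zero]

lemma qv_pow_ne_one {m : ℕ} (hm : m ≠ 0) : qv ^ m ≠ 1 := by
  intro h
  rw [qv, ← map_pow, ← map_one (algebraMap R3 K3)] at h
  have h2 := congrArg (MvPolynomial.eval fun _ : Fin 3 => (2 : ℚ))
    (IsFractionRing.injective R3 K3 h)
  simp only [map_pow, MvPolynomial.eval_X, map_one] at h2
  exact (one_lt_pow₀ one_lt_two hm).ne' h2

/-- Identity (2.3): for even `d ≥ 2` and `n ≡ d+1 (mod 2d)`,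
`Σ_{k=0}^{(dn+n-1)/(2d)} (1-q^{3dk+1-dn-n})(q^{1-dn-n},e,q^{1+d-dn-n}/e;q^{2d})_k
(aq,q/a,q^{d-1-dn-n};q^d)_k /
((1-q^{1-dn-n})(q^d,e,q^{1+d-dn-n}/e;q^d)_k (aq^{2d-dn-n},q^{2d-dn-n}/a,q^{d+2};q^{2d})_k)
· q^{dk} = 0`. -/
theorem stmt9 (d : ℕ) (hd2 : 2 ≤ d) (hdeven : Even d) (n : ℕ) (hn : 0 < n)
    (hmod : n % (2 * d) = (d + 1) % (2 * d)) :
    (∑ k ∈ Finset.range ((d * n + n - 1) / (2 * d) + 1),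
      (1 - qv ^ (3 * (d : ℤ) * k + 1 - d * n - n)) *
        (qPoch (qv ^ (1 - (d : ℤ) * n - n)) (qv ^ (2 * d)) k * qPoch ev (qv ^ (2 * d)) k *
          qPoch (qv ^ (1 + (d : ℤ) - d * n - n) / ev) (qv ^ (2 * d)) k) *
        (qPoch (av * qv) (qv ^ d) k * qPoch (qv / av) (qv ^ d) k *
          qPoch (qv ^ ((d : ℤ) - 1 - d * n - n)) (qv ^ d) k) /
        ((1 - qv ^ (1 - (d : ℤ) * n - n)) *
          (qPoch (qv ^ d) (qv ^ d) k * qPoch ev (qv ^ d) k *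
            qPoch (qv ^ (1 + (d : ℤ) - d * n - n) / ev) (qv ^ d) k) *
          (qPoch (av * qv ^ (2 * (d : ℤ) - d * n - n)) (qv ^ (2 * d)) k *
            qPoch (qv ^ (2 * (d : ℤ) - d * n - n) / av) (qv ^ (2 * d)) k *
            qPoch (qv ^ (d + 2)) (qv ^ (2 * d)) k)) *
        qv ^ (d * k)) = 0 := by
  obtain ⟨N, hN⟩ : ∃ N : ℕ, d * n + n = 2 * d * N + 1 := by
    obtain ⟨r, hr⟩ := hdeven
    rw [Nat.mod_eq_of_lt (show d + 1 < 2 * d by omega)] at hmod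
    have hn' := Nat.div_add_mod n (2 * d)
    rw [hmod] at hn'
    refine ⟨n / (2 * d) * (d + 1) + r + 1, ?_⟩
    generalize n / (2 * d) = t at hn'
    subst hr hn'
    ring
  have hdn : (d : ℤ) * n + n = 2 * d * N + 1 := by exact_mod_cast hN
  rw [hN, Nat.add_sub_cancel, Nat.mul_div_cancel_left N (by omega : 0 < 2 * d)]
  have hq : qv ≠ 0 := by simp [qv]
  have ha : av ≠ 0 := by simp [av]
  have he : ev ≠ 0 := by simp [ev]
  have hpow (m : ℤ) : (qv ^ d) ^ m = qv ^ (d * m : ℤ) := by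
    rw [zpow_mul, zpow_natCast]
  have key := sum_quadTerm_eq_zero (p := qv ^ d) (e := ev) (b := av * qv) (c := qv / av)
    (pow_ne_zero d hq) he (mul_ne_zero ha hq) (div_ne_zero hq ha)
    (fun j => by
      rw [← pow_succ', ← pow_mul]
      exact qv_pow_ne_one (mul_ne_zero (by omega) (Nat.succ_ne_zero j)))
    (fun m => by
      rw [hpow]
      exact algebraMap_ne_zpow (by decide) _)
    (fun m h => algebraMap_ne_zpow (i := 1) (by decide) (d * m - 1) <| by
      rw [zpow_sub₀ hq, zpow_one, ← hpow, ← h]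
      exact (mul_div_cancel_right₀ av hq).symm)
    (fun m h => algebraMap_ne_zpow (i := 1) (by decide) (1 - d * m) <| by
      rw [zpow_sub₀ hq, zpow_one, ← hpow, ← h]
      exact (div_div_cancel₀ hq).symm)
    (fun j => by
      rw [show av * qv * (qv / av) * (qv ^ d) ^ j = qv ^ (2 + d * j) by
        rw [pow_add, pow_mul]; field_simp]
      exact qv_pow_ne_one (by omega))
    (fun m h => algebraMap_ne_zpow (i := 2) (by decide) (d * m - 2) <| by
      rw [zpow_sub₀ hq, ← hpow, ← h]
      change ev = _
      field_simp)
    N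
  set x : K3 := (qv ^ d) ^ (-2 * N : ℤ) with hx
  have hxq (i m : ℤ) (hm : m = i + 1 - (d * n + n)) : qv ^ m = x * qv ^ i := by
    rw [hx, hpow, ← zpow_add₀ hq, hm, hdn]
    congr 1
    ring
  rw [← mul_eq_zero_of_right (1 - x)⁻¹ key, Finset.mul_sum]
  refine Finset.sum_congr rfl fun k _ => ?_
  rw [quadTerm, hxq (3 * d * k) _ (by ring), hxq 0 (1 - d * n - n) (by ring),
    hxq d (1 + d - d * n - n) (by ring), hxq (d - 2) (d - 1 - d * n - n) (by ring),
    hxq (2 * d - 1) (2 * d - d * n - n) (by ring)]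
  have e1 : qv ^ (3 * (d : ℤ) * k) = (qv ^ d) ^ (3 * k) := by
    rw [← pow_mul, ← zpow_natCast]
    congr 1
    push_cast
    ring
  have e2 : qv ^ (2 * d) = (qv ^ d) ^ 2 := by rw [← pow_mul, mul_comm]
  have e3 : x * qv ^ ((d : ℤ) - 2) = x * qv ^ d / (av * qv * (qv / av)) := by
    rw [zpow_sub₀ hq, zpow_natCast]
    field_simp
  have e4 : qv ^ (2 * (d : ℤ) - 1) = (qv ^ d) ^ 2 / qv := by
    rw [zpow_sub₀ hq, zpow_one, ← e2, ← zpow_natCast]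
    norm_cast
  have e5 : av * (x * ((qv ^ d) ^ 2 / qv)) = x * (qv ^ d) ^ 2 / (qv / av) := by field_simp
  have e6 : x * ((qv ^ d) ^ 2 / qv) / av = x * (qv ^ d) ^ 2 / (av * qv) := by field_simp
  have e7 : qv ^ (d + 2) = av * qv * (qv / av) * qv ^ d := by
    rw [pow_add]
    field_simp
  rw [e1, e2, e3, e4, e5, e6, e7, zpow_zero, mul_one, zpow_natCast, ← pow_mul qv d k]
  simp only [div_eq_mul_inv, mul_inv]
  ring

end
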